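/- arXiv:2106.03045 — 2 statements merged into one kernel-verified Lean document; each statement's English description precedes it below -/
import Mathlib

section
/- Let α, β, γ ∈ ℝ with γ ≠ 0. For the Lie algebra 𝔤₂ with its Bott connection ∇^B and symmetrized Ricci tensor ρ̃^B, the triple (𝔤₂, ∇^B, ρ̃^B) is a quasi-statistical structure if and only if α = 0 and β = 0. -/
noncomputable section

/-- The underlying vector space `V = ℝ³`. -/
abbrev V : Type := Fin 3 → ℝ

/-- The basis vector e₁. -/
def e1 : V := ![1, 0, 0]
/-- The basis vector e₂. -/
def e2 : V := ![0, 1, 0]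
/-- The basis vector e₃. -/
def e3 : V := ![0, 0, 1]

/-- The Lorentzian inner product with g(e₁,e₁)=g(e₂,e₂)=1, g(e₃,e₃)=−1. -/
def gL (x y : V) : ℝ := x 0 * y 0 + x 1 * y 1 - x 2 * y 2

/-- Curvature R(X,Y)Z = ∇_X ∇_Y Z − ∇_Y ∇_X Z − ∇_{[X,Y]} Z. -/
def curv (nabla bracket : V → V → V) (x y z : V) : V :=
  nabla x (nabla y z) - nabla y (nabla x z) - nabla (bracket x y) z

/-- Ricci tensor ρ(X,Y) = −g(R(X,e₁)Y,e₁) − g(R(X,e₂)Y,e₂) + g(R(X,e₃)Y,e₃). -/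
def ricci (nabla bracket : V → V → V) (x y : V) : ℝ :=
  - gL (curv nabla bracket x e1 y) e1 - gL (curv nabla bracket x e2 y) e2
  + gL (curv nabla bracket x e3 y) e3

/-- Symmetrized Ricci tensor ρ̃(X,Y) = (ρ(X,Y) + ρ(Y,X))/2. -/
def ricciSym (nabla bracket : V → V → V) (x y : V) : ℝ :=
  (ricci nabla bracket x y + ricci nabla bracket y x) / 2

/-- Covariant derivative of a (left-invariant) bilinear form:
(∇_X ω)(Y,Z) = −ω(∇_X Y, Z) − ω(Y, ∇_X Z). -/
def covDer (nabla : V → V → V) (ω : V → V → ℝ) (x y z : V) : ℝ :=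
  - ω (nabla x y) z - ω y (nabla x z)

/-- ω is a Codazzi tensor for ∇: (∇_X ω)(Y,Z) = (∇_Y ω)(X,Z) for all X,Y,Z. -/
def IsCodazzi (nabla : V → V → V) (ω : V → V → ℝ) : Prop :=
  ∀ x y z : V, covDer nabla ω x y z = covDer nabla ω y x z

/-- Torsion T(X,Y) = ∇_X Y − ∇_Y X − [X,Y]. -/
def torsion (nabla bracket : V → V → V) (x y : V) : V :=
  nabla x y - nabla y x - bracket x y

/-- (V,∇,ω) is a quasi-statistical structure:
(∇_X ω)(Y,Z) − (∇_Y ω)(X,Z) + ω(T(X,Y),Z) = 0 for all X,Y,Z. -/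
def IsQuasiStatistical (nabla bracket : V → V → V) (ω : V → V → ℝ) : Prop :=
  ∀ x y z : V,
    covDer nabla ω x y z - covDer nabla ω y x z + ω (torsion nabla bracket x y) z = 0

/-- The Lie bracket of the Lie algebra 𝔤2. -/
def bracket (α β γ : ℝ) (x y : V) : V :=
  ![ (x 1 * y 2 - x 2 * y 1) * (α),
     (x 0 * y 1 - x 1 * y 0) * (γ) + (x 0 * y 2 - x 2 * y 0) * (-β),
     (x 0 * y 1 - x 1 * y 0) * (-β) + (x 0 * y 2 - x 2 * y 0) * (-γ) ]

/-- The Bott connection ∇^B of 𝔤2. -/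
def nabla (α β γ : ℝ) (x y : V) : V :=
  ![ x 1 * y 1 * (γ) + x 2 * y 1 * (-α),
     x 1 * y 0 * (-γ) + x 2 * y 0 * (β),
     x 0 * y 2 * (-γ) ]

/-- The symmetrized Ricci tensor of the Bott connection of 𝔤₂ in coordinates. -/
theorem ricciSym_nabla_bracket (α β γ : ℝ) (x y : V) :
    ricciSym (nabla α β γ) (bracket α β γ) x y =
      -(β ^ 2 + γ ^ 2) * (x 0 * y 0) - (γ ^ 2 + α * β) * (x 1 * y 1)
        - α * γ / 2 * (x 1 * y 2 + x 2 * y 1) := by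
  simp [ricciSym, ricci, curv, gL, nabla, bracket, e1, e2, e3]
  ring

theorem stmt7 (α β γ : ℝ) (hγ : γ ≠ 0) :
    IsQuasiStatistical (nabla α β γ) (bracket α β γ) (ricciSym (nabla α β γ) (bracket α β γ)) ↔ (α = 0 ∧ β = 0) := by
  constructor
  · intro h
    have h₁ := h e1 e3 e2
    have h₂ := h e1 e3 e3
    simp only [covDer, ricciSym_nabla_bracket] at h₁ h₂
    simp [torsion, nabla, bracket, e1, e2, e3] at h₁ h₂
    have hα : α = 2 * β := by
      apply mul_left_cancel₀ (pow_ne_zero 2 hγ)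
      linear_combination 2 * h₁
    have hβ : β = 0 := by
      subst hα
      simp_all
    exact ⟨by rw [hα, hβ, mul_zero], hβ⟩
  · rintro ⟨rfl, rfl⟩ x y z
    simp only [covDer, ricciSym_nabla_bracket]
    simp [torsion, nabla, bracket]
    ring

end
end

section
/- Let α, β, γ ∈ ℝ with γ ≠ 0. For the Lie algebra 𝔤₂ with its Kobayashi–Nomizu connection ∇^k, the symmetrized Ricci tensor ρ̃^k of ∇^k is a Codazzi tensor for ∇^k if and only if α = 0 and β = 0. -/
noncomputable section

/-- The symmetrized Ricci tensor of the Kobayashi–Nomizu connection of 𝔤2 in coordinates. -/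
theorem ricciSym_nabla (α β γ : ℝ) (x y : V) :
    ricciSym (nabla α β γ) (bracket α β γ) x y =
      -(γ ^ 2 + β ^ 2) * (x 0 * y 0) - (γ ^ 2 + α * β) * (x 1 * y 1)
        - α * γ / 2 * (x 1 * y 2 + x 2 * y 1) := by
  simp [ricciSym, ricci, curv, gL, nabla, bracket, e1, e2, e3]
  ring

theorem stmt14 (α β γ : ℝ) (hγ : γ ≠ 0) :
    IsCodazzi (nabla α β γ) (ricciSym (nabla α β γ) (bracket α β γ)) ↔ (α = 0 ∧ β = 0) := by
  simp only [IsCodazzi, covDer, ricciSym_nabla]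
  constructor
  · intro h
    have h₁₂₂ := h e1 e2 e2
    have h₁₃₂ := h e1 e3 e2
    have h₁₃₃ := h e1 e3 e3
    simp [nabla, e1, e2, e3] at h₁₂₂ h₁₃₂ h₁₃₃
    have hαβ : α * β = 0 := by grind
    have hβ : β = 0 := by grind
    exact ⟨by grind, hβ⟩
  · rintro ⟨rfl, rfl⟩ x y z
    simp [nabla]
    ring

end
end
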